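/- Let {S_{a^[k]}, k≥0} be a local, bounded non-stationary subdivision scheme which reproduces constants and satisfies Condition A, with constants K ≥ 0, n > 0 and μ < 1 as in Condition A, and set μ̂ := μ^{1/n}. Then there exists a positive constant C₁ such that for every bounded initial sequence f^[0] and every k ≥ 0, ‖Δ f^[k]‖_∞ ≤ C₁ μ̂^k ‖Δ f^[0]‖_∞, where f^[k+1] = S_{a^[k]} f^[k]. -/

import Mathlib

open Filter Set

/-- The subdivision operator associated to a mask `a`: `(S_a f)_i = ∑_j a_{i-2j} f_j`. -/
noncomputable def subOp (a : ℤ → ℝ) (f : ℤ → ℝ) : ℤ → ℝ :=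
  fun i => ∑ᶠ j : ℤ, a (i - 2 * j) * f j

/-- The difference mask `q` of a mask `a`: `q_i = ∑_{j ≤ i} (-1)^(i-j) a_j`. -/
noncomputable def diffMask (a : ℤ → ℝ) : ℤ → ℝ :=
  fun i => ∑ᶠ j ∈ {j : ℤ | j ≤ i}, (-1 : ℝ) ^ (i - j) * a j

/-- A sequence is bounded. -/
def IsBoundedSeq (f : ℤ → ℝ) : Prop := ∃ M : ℝ, ∀ i, |f i| ≤ M

/-- Sup-norm of a sequence. -/
noncomputable def seqNorm (f : ℤ → ℝ) : ℝ := ⨆ i : ℤ, |f i|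

/-- Operator sup-norm of an operator on sequences, taken over bounded sequences of
sup-norm at most one. -/
noncomputable def opNorm (T : (ℤ → ℝ) → ℤ → ℝ) : ℝ :=
  sSup { c : ℝ | ∃ f : ℤ → ℝ, IsBoundedSeq f ∧ seqNorm f ≤ 1 ∧ c = seqNorm (T f) }

/-- The hat function `H(x) = max (1 - |x|) 0`. -/
noncomputable def hatF (x : ℝ) : ℝ := max (1 - |x|) 0

/-- The piecewise linear interpolant at level `k` of the data `f` on the grid `2^{-k} ℤ`. -/
noncomputable def PL (k : ℕ) (f : ℤ → ℝ) : ℝ → ℝ :=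
  fun x => ∑ᶠ i : ℤ, f i * hatF (2 ^ k * x - (i : ℝ))

/-- Backward difference operator on sequences. -/
def bdiff (f : ℤ → ℝ) : ℤ → ℝ := fun i => f i - f (i - 1)

/-- `compOps q k n = S_{q^[k+n-1]} ∘ ⋯ ∘ S_{q^[k+1]} ∘ S_{q^[k]}`. -/
noncomputable def compOps (q : ℕ → ℤ → ℝ) (k : ℕ) : ℕ → (ℤ → ℝ) → ℤ → ℝ
  | 0 => id
  | n + 1 => subOp (q (k + n)) ∘ compOps q k n

/-- A mask reproduces constants: `∑_i a_{2i} = ∑_i a_{2i+1} = 1`. -/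
def ReproducesConstants (a : ℤ → ℝ) : Prop :=
  (∑ᶠ i : ℤ, a (2 * i)) = 1 ∧ (∑ᶠ i : ℤ, a (2 * i + 1)) = 1

/-- Two sequences of masks are asymptotically similar. -/
def AsympSimilar (a b : ℕ → ℤ → ℝ) : Prop :=
  Tendsto (fun k => seqNorm (fun i => a k i - b k i)) atTop (nhds 0)

/-- Condition A for a non-stationary scheme with masks `a`. -/
def ConditionA (a : ℕ → ℤ → ℝ) : Prop :=
  ∃ K n : ℕ, 0 < n ∧ ∃ μ : ℝ, μ < 1 ∧
    ∀ k, K ≤ k → opNorm (compOps (fun j => diffMask (a j)) k n) ≤ μ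


lemma finSupp {N : ℕ} {q : ℤ → ℝ} (hq : ∀ i : ℤ, (N : ℤ) < |i| → q i = 0) (f : ℤ → ℝ) (i : ℤ) :
    Function.support (fun j => q (i - 2 * j) * f j) ⊆
      ((Finset.Icc (i / 2 - N - 1) (i / 2 + N + 1) : Finset ℤ) : Set ℤ) := by
  intro j hj
  by_contra h
  apply hj
  have : q (i - 2 * j) = 0 := by
    apply hq
    simp only [Finset.coe_Icc, Set.mem_Icc] at h
    rw [lt_abs]
    omega
  simp [this]

lemma finSupp' {N : ℕ} {q : ℤ → ℝ} (hq : ∀ i : ℤ, (N : ℤ) < |i| → q i = 0) (f : ℤ → ℝ) (i : ℤ) :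
    (Function.support (fun j => q (i - 2 * j) * f j)).Finite :=
  (Finset.finite_toSet _).subset (finSupp hq f i)

lemma subOp_eq {N : ℕ} {q : ℤ → ℝ} (hq : ∀ i : ℤ, (N : ℤ) < |i| → q i = 0) (f : ℤ → ℝ) (i : ℤ) :
    subOp q f i = ∑ j ∈ Finset.Icc (i / 2 - N - 1) (i / 2 + N + 1), q (i - 2 * j) * f j :=
  finsum_eq_sum_of_support_subset _ (finSupp hq f i)

lemma subOp_bound {N : ℕ} {q : ℤ → ℝ} (hq : ∀ i : ℤ, (N : ℤ) < |i| → q i = 0) {Q : ℝ}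
    (hQ : ∀ i, |q i| ≤ Q) {f : ℤ → ℝ} {c : ℝ} (hf : ∀ i, |f i| ≤ c) (i : ℤ) :
    |subOp q f i| ≤ ((2 * N + 3 : ℕ) : ℝ) * Q * c := by
  rw [subOp_eq hq]
  refine (Finset.abs_sum_le_sum_abs _ _).trans ?_
  have : ∀ j ∈ Finset.Icc (i / 2 - N - 1) (i / 2 + N + 1), |q (i - 2 * j) * f j| ≤ Q * c := by
    intro j _
    rw [abs_mul]
    exact mul_le_mul (hQ _) (hf _) (abs_nonneg _) ((abs_nonneg _).trans (hQ 0))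
  refine (Finset.sum_le_card_nsmul _ _ _ this).trans ?_
  have hc : (Finset.Icc (i / 2 - N - 1 : ℤ) (i / 2 + N + 1)).card = 2 * N + 3 := by
    simp only [Int.card_Icc]; omega
  rw [hc, nsmul_eq_mul, mul_assoc]

lemma diffMask_eq {N : ℕ} {a : ℤ → ℝ} (ha : ∀ i : ℤ, (N : ℤ) < |i| → a i = 0) (i : ℤ) :
    diffMask a i = ∑ j ∈ Finset.Icc (-(N : ℤ)) i, (-1 : ℝ) ^ (i - j) * a j := by
  unfold diffMask
  apply finsum_mem_eq_sum_of_subset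
  · rintro j ⟨h1, h2⟩
    simp only [Finset.coe_Icc, Set.mem_Icc]
    refine ⟨?_, h1⟩
    by_contra h
    apply h2
    have : a j = 0 := ha _ (by rw [lt_abs]; omega)
    simp [this]
  · intro j hj
    simp at hj
    exact hj.2

lemma diffMask_rec {N : ℕ} {a : ℤ → ℝ} (ha : ∀ i : ℤ, (N : ℤ) < |i| → a i = 0) (i : ℤ) :
    a i = diffMask a i + diffMask a (i - 1) := by
  rw [diffMask_eq ha, diffMask_eq ha]
  by_cases h : -(N : ℤ) ≤ i
  · have e : Finset.Icc (-(N : ℤ)) i = insert i (Finset.Icc (-(N : ℤ)) (i - 1)) := by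
      ext j; simp only [Finset.mem_Icc, Finset.mem_insert]; omega
    rw [e, Finset.sum_insert (by simp)]
    have : ∀ j, (-1 : ℝ) ^ (i - j) * a j = - ((-1 : ℝ) ^ (i - 1 - j) * a j) := by
      intro j
      rw [show i - j = (i - 1 - j) + 1 by ring, zpow_add₀ (by norm_num)]
      simp
    rw [Finset.sum_congr rfl (fun j _ => this j), Finset.sum_neg_distrib]
    simp
  · rw [Finset.Icc_eq_empty (by omega), Finset.Icc_eq_empty (by omega)]
    simp
    exact ha _ (by rw [lt_abs]; omega)

lemma diffMask_N {N : ℕ} {a : ℤ → ℝ} (ha : ∀ i : ℤ, (N : ℤ) < |i| → a i = 0)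
    (hr : ReproducesConstants a) : diffMask a N = 0 := by
  have h1 : diffMask a N = (-1 : ℝ) ^ (N : ℤ) * ∑ᶠ j : ℤ, (-1 : ℝ) ^ (-j) * a j := by
    rw [diffMask_eq ha, finsum_eq_sum_of_support_subset (s := Finset.Icc (-(N : ℤ)) N),
      Finset.mul_sum]
    · refine Finset.sum_congr rfl fun j _ => ?_
      rw [sub_eq_add_neg, zpow_add₀ (by norm_num), mul_assoc]
    · intro j hj
      by_contra h
      apply hj
      have : a j = 0 := ha _ (by
        simp only [Finset.coe_Icc, Set.mem_Icc] at h
        rw [lt_abs]; omega)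
      simp [this]
  have hfin : ∀ s : Set ℤ, (s ∩ Function.support (fun j : ℤ => (-1 : ℝ) ^ (-j) * a j)).Finite := by
    intro s
    refine (Finset.finite_toSet (Finset.Icc (-(N : ℤ)) N)).subset ?_
    rintro j ⟨_, hj⟩
    by_contra h
    apply hj
    have : a j = 0 := ha _ (by
      simp only [Finset.coe_Icc, Set.mem_Icc] at h
      rw [lt_abs]; omega)
    simp [this]
  have hu : (Set.univ : Set ℤ) = Set.range (fun i : ℤ => 2 * i) ∪ Set.range (fun i : ℤ => 2 * i + 1) := by
    ext j
    simp only [Set.mem_univ, Set.mem_union, Set.mem_range, true_iff]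
    rcases Int.even_or_odd' j with ⟨k, h | h⟩
    · exact Or.inl ⟨k, h.symm⟩
    · exact Or.inr ⟨k, h.symm⟩
  have hd : Disjoint (Set.range (fun i : ℤ => 2 * i)) (Set.range (fun i : ℤ => 2 * i + 1)) := by
    rw [Set.disjoint_left]
    rintro _ ⟨x, rfl⟩ ⟨y, hy⟩
    simp only at hy
    omega
  rw [h1, ← finsum_mem_univ, hu, finsum_mem_union' hd (hfin _) (hfin _),
    finsum_mem_range (fun x y h => by simpa using h),
    finsum_mem_range (fun x y h => by simpa using h)]
  have e1 : ∀ j : ℤ, (-1 : ℝ) ^ (-(2 * j)) * a (2 * j) = a (2 * j) := by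
    intro j
    rw [Even.neg_one_zpow (by simp), one_mul]
  have e2 : ∀ j : ℤ, (-1 : ℝ) ^ (-(2 * j + 1)) * a (2 * j + 1) = (-1) * a (2 * j + 1) := by
    intro j
    rw [Odd.neg_one_zpow ⟨-j - 1, by ring⟩]
  rw [finsum_congr e1, finsum_congr e2, ← mul_finsum, hr.1, hr.2]
  simp

lemma diffMask_loc {N : ℕ} {a : ℤ → ℝ} (ha : ∀ i : ℤ, (N : ℤ) < |i| → a i = 0)
    (hr : ReproducesConstants a) (i : ℤ) (hi : (N : ℤ) < |i|) : diffMask a i = 0 := by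
  rcases lt_abs.1 hi with h | h
  · have key : ∀ m : ℕ, diffMask a (N + m) = 0 := by
      intro m
      induction m with
      | zero => simpa using diffMask_N ha hr
      | succ m ih =>
        have := diffMask_rec ha (N + (m + 1 : ℕ))
        rw [ha _ (by rw [lt_abs]; omega)] at this
        rw [show ((N : ℤ) + (m + 1 : ℕ) - 1) = N + m by push_cast; ring, ih] at this
        linarith
    have := key (i - N).toNat
    rwa [show ((N : ℤ) + (i - N).toNat) = i by omega] at this
  · rw [diffMask_eq ha, Finset.Icc_eq_empty (by omega)]
    simp

lemma diffMask_bound {N : ℕ} {a : ℤ → ℝ} (ha : ∀ i : ℤ, (N : ℤ) < |i| → a i = 0)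
    (hr : ReproducesConstants a) {M : ℝ} (hM : ∀ i, |a i| ≤ M) (i : ℤ) :
    |diffMask a i| ≤ ((2 * N + 1 : ℕ) : ℝ) * M := by
  have hM0 : 0 ≤ M := (abs_nonneg _).trans (hM 0)
  by_cases h : (N : ℤ) < |i|
  · rw [diffMask_loc ha hr i h, abs_zero]
    positivity
  · rw [diffMask_eq ha]
    refine (Finset.abs_sum_le_sum_abs _ _).trans ?_
    have : ∀ j ∈ Finset.Icc (-(N : ℤ)) i, |(-1 : ℝ) ^ (i - j) * a j| ≤ M := by
      intro j _
      rw [abs_mul, abs_zpow]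
      simpa using hM j
    refine (Finset.sum_le_card_nsmul _ _ _ this).trans ?_
    rw [nsmul_eq_mul]
    have hc : (Finset.Icc (-(N : ℤ)) i).card ≤ 2 * N + 1 := by
      simp only [Int.card_Icc]
      rw [lt_abs] at h
      omega
    gcongr

lemma bdiff_subOp {N : ℕ} {a : ℤ → ℝ} (ha : ∀ i : ℤ, (N : ℤ) < |i| → a i = 0)
    (hr : ReproducesConstants a) (f : ℤ → ℝ) :
    bdiff (subOp a f) = subOp (diffMask a) (bdiff f) := by
  have hq := diffMask_loc ha hr
  set q := diffMask a with hqd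
  have h1 : ∀ i, subOp a f i = subOp q f i + subOp q f (i - 1) := by
    intro i
    unfold subOp
    rw [← finsum_add_distrib (finSupp' hq f i) (finSupp' hq f (i - 1))]
    refine finsum_congr fun j => ?_
    rw [diffMask_rec ha (i - 2 * j), ← hqd, show i - 2 * j - 1 = i - 1 - 2 * j by ring]
    ring
  have h2 : ∀ i, subOp q (fun j => f (j - 1)) i = subOp q f (i - 2) := by
    intro i
    unfold subOp
    rw [← finsum_comp_equiv (Equiv.addRight (1 : ℤ))]
    refine finsum_congr fun j => ?_
    simp only [Equiv.coe_addRight]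
    rw [show i - 2 * (j + 1) = i - 2 - 2 * j by ring, add_sub_cancel_right]
  have h3 : ∀ i, subOp q (bdiff f) i = subOp q f i - subOp q (fun j => f (j - 1)) i := by
    intro i
    unfold subOp
    rw [← finsum_sub_distrib (finSupp' hq f i) (finSupp' hq _ i)]
    refine finsum_congr fun j => ?_
    simp only [bdiff]
    ring
  funext i
  rw [h3, h2]
  simp only [bdiff]
  rw [h1, h1, show i - 1 - 1 = i - 2 by ring]
  ring

lemma le_seqNorm {f : ℤ → ℝ} (hf : IsBoundedSeq f) (i : ℤ) : |f i| ≤ seqNorm f := by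
  obtain ⟨M, hM⟩ := hf
  exact le_ciSup (f := fun i => |f i|) ⟨M, by rintro _ ⟨i, rfl⟩; exact hM i⟩ i

lemma seqNorm_le {f : ℤ → ℝ} {c : ℝ} (hf : ∀ i, |f i| ≤ c) : seqNorm f ≤ c := ciSup_le hf

lemma seqNorm_nonneg (f : ℤ → ℝ) : 0 ≤ seqNorm f := Real.iSup_nonneg fun i => abs_nonneg _

lemma compOps_smul (q : ℕ → ℤ → ℝ) (k n : ℕ) (c : ℝ) (f : ℤ → ℝ) :
    compOps q k n (fun i => c * f i) = fun i => c * compOps q k n f i := by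
  induction n with
  | zero => rfl
  | succ n ih =>
    simp only [compOps, Function.comp]
    rw [ih]
    funext i
    unfold subOp
    rw [mul_finsum]
    exact finsum_congr fun j => by ring

lemma compOps_bound {q : ℕ → ℤ → ℝ} {B : ℝ}
    (hB : ∀ k f c, (∀ i, |f i| ≤ c) → ∀ i, |subOp (q k) f i| ≤ B * c)
    (k n : ℕ) (f : ℤ → ℝ) (c : ℝ) (hf : ∀ i, |f i| ≤ c) (i : ℤ) :
    |compOps q k n f i| ≤ B ^ n * c := by
  induction n generalizing i with
  | zero => simpa [compOps] using hf i
  | succ n ih =>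
    simp only [compOps, Function.comp]
    rw [pow_succ', mul_assoc]
    exact hB _ _ _ ih i

lemma compOps_contr {q : ℕ → ℤ → ℝ} {B : ℝ}
    (hB : ∀ k f c, (∀ i, |f i| ≤ c) → ∀ i, |subOp (q k) f i| ≤ B * c)
    (k n : ℕ) {μ : ℝ} (hμ : opNorm (compOps q k n) ≤ μ) (hB0 : 0 ≤ B)
    (f : ℤ → ℝ) (hf : IsBoundedSeq f) :
    seqNorm (compOps q k n f) ≤ μ * seqNorm f := by
  rcases (seqNorm_nonneg f).eq_or_lt with h0 | h0
  · rw [← h0, mul_zero]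
    refine seqNorm_le fun i => ?_
    have := compOps_bound hB k n f 0 (fun i => by rw [h0]; exact le_seqNorm hf i) i
    simpa using this
  · set s := seqNorm f with hs
    set g : ℤ → ℝ := fun i => s⁻¹ * f i with hg
    have hg1 : ∀ i, |g i| ≤ 1 := by
      intro i
      rw [hg]
      simp only [abs_mul, abs_inv, abs_of_pos h0]
      rw [inv_mul_le_iff₀ h0, mul_one]
      exact le_seqNorm hf i
    have hgn : seqNorm (compOps q k n g) ≤ μ := by
      refine le_trans (le_csSup ?_ ?_) hμ
      · refine ⟨B ^ n, ?_⟩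
        rintro _ ⟨u, hu, hu1, rfl⟩
        refine seqNorm_le fun i => ?_
        simpa using compOps_bound hB k n u 1 (fun i => (le_seqNorm hu i).trans hu1) i
      · exact ⟨g, ⟨1, hg1⟩, seqNorm_le hg1, rfl⟩
    have hgb : IsBoundedSeq (compOps q k n g) := ⟨_, compOps_bound hB k n g 1 hg1⟩
    have hfg : f = fun i => s * g i := by
      funext i
      rw [hg]
      field_simp
    refine seqNorm_le fun i => ?_
    rw [hfg, compOps_smul, abs_mul, abs_of_pos h0, mul_comm]
    gcongr
    exact (le_seqNorm hgb i).trans hgn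

lemma exists_top {N : ℕ} {a : ℤ → ℝ} (ha : ∀ i : ℤ, (N : ℤ) < |i| → a i = 0)
    (hr : ReproducesConstants a) : ∃ m, a m ≠ 0 ∧ ∀ i, m < i → a i = 0 := by
  have hne : ∃ z, a z ≠ 0 := by
    by_contra h
    push Not at h
    have := hr.1
    simp [h] at this
  obtain ⟨m, h1, h2⟩ := Int.exists_greatest_of_bdd (P := fun z => a z ≠ 0)
    ⟨N, fun z hz => by
      by_contra h
      exact hz (ha z (by rw [lt_abs]; omega))⟩ hne
  refine ⟨m, h1, fun i hi => ?_⟩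
  by_contra h
  have := h2 i h
  omega

lemma subOp_top {a f : ℤ → ℝ} (ha : ∃ m, a m ≠ 0 ∧ ∀ i, m < i → a i = 0)
    (hf : ∃ m, f m ≠ 0 ∧ ∀ i, m < i → f i = 0) :
    ∃ m, subOp a f m ≠ 0 ∧ ∀ i, m < i → subOp a f i = 0 := by
  obtain ⟨m, hm, hm'⟩ := ha
  obtain ⟨p, hp, hp'⟩ := hf
  refine ⟨m + 2 * p, ?_, ?_⟩
  · unfold subOp
    rw [finsum_eq_single _ p]
    · simp [hm, hp]
    · intro j hj
      rcases lt_or_gt_of_ne hj with h | h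
      · rw [hm' _ (by omega), zero_mul]
      · rw [hp' _ h, mul_zero]
  · intro i hi
    unfold subOp
    rw [← finsum_zero (α := ℤ)]
    refine finsum_congr fun j => ?_
    by_cases h : p < j
    · rw [hp' _ h, mul_zero]
    · rw [hm' _ (by omega), zero_mul]

lemma bdiff_compOps {a : ℕ → ℤ → ℝ} {N : ℕ}
    (hlocal : ∀ k, ∀ i : ℤ, (N : ℤ) < |i| → a k i = 0)
    (hrc : ∀ k, ReproducesConstants (a k)) (fs : ℕ → ℤ → ℝ) (k : ℕ)
    (h : ∀ m, fs (m + 1) = subOp (a (k + m)) (fs m)) (n : ℕ) :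
    bdiff (fs n) = compOps (fun j => diffMask (a j)) k n (bdiff (fs 0)) := by
  induction n with
  | zero => rfl
  | succ n ih =>
    rw [h, bdiff_subOp (hlocal _) (hrc _), ih]
    rfl

lemma compOps_top {a : ℕ → ℤ → ℝ} {N : ℕ}
    (hlocal : ∀ k, ∀ i : ℤ, (N : ℤ) < |i| → a k i = 0)
    (hrc : ∀ k, ReproducesConstants (a k)) (k n : ℕ) (f : ℤ → ℝ)
    (hf : ∃ m, f m ≠ 0 ∧ ∀ i, m < i → f i = 0) :
    ∃ m, compOps a k n f m ≠ 0 ∧ ∀ i, m < i → compOps a k n f i = 0 := by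
  induction n with
  | zero => exact hf
  | succ n ih => exact subOp_top (exists_top (hlocal _) (hrc _)) ih

lemma bdiff_bounded {f : ℤ → ℝ} (hf : IsBoundedSeq f) : IsBoundedSeq (bdiff f) := by
  obtain ⟨M, hM⟩ := hf
  exact ⟨M + M, fun i => (abs_sub _ _).trans (add_le_add (hM _) (hM _))⟩

/-- under Condition A (with constants `K`, `n`, `μ`, `μ̂ = μ^{1/n}`),
the backward differences of the generated data decay geometrically:
`‖Δ f^[k]‖ ≤ C₁ μ̂^k ‖Δ f⁰‖`. -/
theorem contraction_of_differences
    (a : ℕ → ℤ → ℝ) (N : ℕ) (hN : 0 < N)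
    (hlocal : ∀ k, ∀ i : ℤ, (N : ℤ) < |i| → a k i = 0)
    (hbdd : ∃ M : ℝ, ∀ k, ∀ i : ℤ, |a k i| ≤ M)
    (hrc : ∀ k, ReproducesConstants (a k))
    (K n : ℕ) (hn : 0 < n) (μ : ℝ) (hμ0 : 0 ≤ μ) (hμ1 : μ < 1)
    (hA : ∀ k, K ≤ k → opNorm (compOps (fun j => diffMask (a j)) k n) ≤ μ) :
    ∃ C₁ : ℝ, 0 < C₁ ∧ ∀ f0 : ℤ → ℝ, IsBoundedSeq f0 → ∀ fs : ℕ → ℤ → ℝ, fs 0 = f0 →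
      (∀ k, fs (k + 1) = subOp (a k) (fs k)) →
      ∀ k : ℕ, seqNorm (bdiff (fs k)) ≤
        C₁ * (μ ^ ((1 : ℝ) / (n : ℝ))) ^ k * seqNorm (bdiff f0) := by
  obtain ⟨M, hM⟩ := hbdd
  have hM0 : 0 ≤ M := (abs_nonneg _).trans (hM 0 0)
  obtain ⟨B, hB1, hB⟩ : ∃ B : ℝ, 1 ≤ B ∧ ∀ k f c, (∀ i, |f i| ≤ c) →
      ∀ i, |subOp (diffMask (a k)) f i| ≤ B * c := by
    refine ⟨max 1 (((2 * N + 3 : ℕ) : ℝ) * (((2 * N + 1 : ℕ) : ℝ) * M)), le_max_left _ _, ?_⟩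
    intro k f c hf i
    have hc : 0 ≤ c := (abs_nonneg _).trans (hf 0)
    refine (subOp_bound (diffMask_loc (hlocal k) (hrc k))
      (diffMask_bound (hlocal k) (hrc k) (hM k)) hf i).trans ?_
    gcongr
    exact le_max_right _ _
  have hB0 : 0 ≤ B := by linarith
  have hμpos : 0 < μ := by
    rcases hμ0.eq_or_lt with h0 | h0
    · exfalso
      set d : ℤ → ℝ := fun i => if i = 0 then 1 else 0 with hd
      have hdb : IsBoundedSeq d := ⟨1, fun i => by rw [hd]; dsimp only; split_ifs <;> simp⟩
      obtain ⟨m, h1, h2⟩ := compOps_top hlocal hrc K n d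
        ⟨0, by simp [hd], fun i hi => by simp [hd, hi.ne']⟩
      have hc := compOps_contr (q := fun j => diffMask (a j)) hB K n (hA K le_rfl) hB0 (bdiff d)
        (bdiff_bounded hdb)
      have he := bdiff_compOps hlocal hrc (fun m => compOps a K m d) K (fun m => rfl) n
      simp only [compOps, id] at he
      obtain ⟨c, hcb⟩ := bdiff_bounded hdb
      have hb : IsBoundedSeq (compOps (fun j => diffMask (a j)) K n (bdiff d)) :=
        ⟨_, compOps_bound (q := fun j => diffMask (a j)) hB K n _ c hcb⟩
      have hz := (le_seqNorm hb (m + 1)).trans hc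
      rw [← h0, zero_mul, ← he] at hz
      have hz' := abs_eq_zero.1 (le_antisymm hz (abs_nonneg _))
      simp only [bdiff] at hz'
      rw [h2 (m + 1) (by omega), show m + 1 - 1 = m by ring] at hz'
      exact h1 (by linarith)
    · exact h0
  set r : ℝ := μ ^ ((1 : ℝ) / (n : ℝ)) with hr
  have hr0 : 0 < r := Real.rpow_pos_of_pos hμpos _
  have hrn : r ^ n = μ := by
    rw [hr, one_div]
    exact Real.rpow_inv_natCast_pow hμ0 hn.ne'
  have hr1 : r ≤ 1 := Real.rpow_le_one hμ0 hμ1.le (by positivity)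
  refine ⟨B ^ (K + n) / r ^ (K + n), by positivity, ?_⟩
  intro f0 hf0 fs hfs0 hfs k
  have hD0 : 0 ≤ seqNorm (bdiff f0) := seqNorm_nonneg _
  have hgrow : ∀ k i, |bdiff (fs k) i| ≤ B ^ k * seqNorm (bdiff f0) := by
    intro k i
    have := bdiff_compOps hlocal hrc fs 0 (fun m => by rw [zero_add]; exact hfs m) k
    rw [this, hfs0]
    exact compOps_bound (q := fun j => diffMask (a j)) hB 0 k _ _
      (fun i => le_seqNorm (bdiff_bounded hf0) i) i
  induction k using Nat.strong_induction_on with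
  | _ k ih =>
    rcases le_or_gt k (K + n) with h | h
    · refine (seqNorm_le (hgrow k)).trans ?_
      gcongr
      have e1 : B ^ k ≤ B ^ (K + n) := pow_le_pow_right₀ hB1 h
      have e2 : r ^ (K + n) ≤ r ^ k := pow_le_pow_of_le_one hr0.le hr1 h
      rw [div_mul_eq_mul_div, le_div_iff₀ (by positivity)]
      gcongr
    · obtain ⟨p, rfl⟩ : ∃ p, k = p + n := ⟨k - n, by omega⟩
      have := bdiff_compOps hlocal hrc (fun m => fs (p + m)) p (fun m => hfs (p + m)) n
      simp only [add_zero] at this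
      rw [this]
      refine (compOps_contr (q := fun j => diffMask (a j)) hB p n (hA p (by omega)) hB0 _
        ⟨_, hgrow p⟩).trans ?_
      calc μ * seqNorm (bdiff (fs p))
          ≤ μ * (B ^ (K + n) / r ^ (K + n) * r ^ p * seqNorm (bdiff f0)) := by
            gcongr
            exact ih p (by omega)
        _ = _ := by rw [pow_add r p n, hrn]; ring
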